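/- Let K be a complete discrete valuation field with perfect residue field, and let L/K be a nontrivial finite tame Galois extension (i.e. L ≠ K and u_{L/K} ≤ 1). Then L/K does not satisfy Fontaine's property (P_m) for m = u_{L/K}. -/

import Mathlib

noncomputable section

open scoped Classical

set_option synthInstance.maxHeartbeats 400000

namespace Fontaine

/-! ### The ambient setting

`K` is a field, `Ω` a fixed algebraic closure of `K`, and `v : Ω → ℝ` is (the unique)
additive valuation on `Ω` extending the normalized discrete valuation of `K`
(so that `v (K^×) = ℤ`), with `K` complete.  Algebraic extensions `E / K` are
intermediate fields of `Ω / K`. -/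

/-- `v` is an additive valuation on `Ω`, extending the normalized discrete valuation
of the complete field `K` (the value of `v` at `0` is irrelevant junk). The
Galois-invariance and completeness clauses are true (and uniquely determining)
properties of this situation. -/
structure IsCDV (K Ω : Type) [Field K] [Field Ω] [Algebra K Ω] (v : Ω → ℝ) : Prop where
  map_mul : ∀ x y : Ω, x ≠ 0 → y ≠ 0 → v (x * y) = v x + v y
  add_ge : ∀ x y : Ω, x ≠ 0 → y ≠ 0 → x + y ≠ 0 → min (v x) (v y) ≤ v (x + y)
  int_valued : ∀ x : K, x ≠ 0 → ∃ n : ℤ, v (algebraMap K Ω x) = (n : ℝ)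
  exists_uniformizer : ∃ x : K, v (algebraMap K Ω x) = 1
  galois_inv : ∀ (E : IntermediateField K Ω) (σ : ↥E ≃ₐ[K] ↥E) (x : ↥E),
    v ((σ x : Ω)) = v (x : Ω)
  complete : ∀ x : ℕ → K,
    (∀ N : ℝ, ∃ n₀ : ℕ, ∀ i j : ℕ, n₀ ≤ i → n₀ ≤ j →
      x i = x j ∨ N ≤ v (algebraMap K Ω (x i - x j))) →
    ∃ y : K, ∀ N : ℝ, ∃ n₀ : ℕ, ∀ i : ℕ, n₀ ≤ i →
      x i = y ∨ N ≤ v (algebraMap K Ω (x i - y))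

variable {K Ω : Type} [Field K] [Field Ω] [Algebra K Ω] (v : Ω → ℝ)

/-- `x` belongs to the ring of integers `O_E` of `E`. -/
def IsInt (E : IntermediateField K Ω) (x : Ω) : Prop :=
  x ∈ E ∧ (x = 0 ∨ 0 ≤ v x)

/-- The minimal positive value of `v` on `F`; it equals `1 / e_{F/K}`. -/
def minVal (F : IntermediateField K Ω) : ℝ :=
  sInf {r : ℝ | 0 < r ∧ ∃ x ∈ F, v x = r}

/-- The ramification index `e_{F/K}`. -/
def ramIdx (F : IntermediateField K Ω) : ℝ := (minVal v F)⁻¹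

/-- The valuation normalized with respect to the base field `F`
(so that `vRel v F (F^×) = ℤ`); this is `v_F`. -/
def vRel (F : IntermediateField K Ω) (x : Ω) : ℝ := v x * ramIdx v F

/-- `x` lies in the ideal `a_{E/F}^m = {x ∈ O_E : v_F x ≥ m}` (valuation condition). -/
def InId (F : IntermediateField K Ω) (m : ℝ) (x : Ω) : Prop :=
  x = 0 ∨ m ≤ vRel v F x

/-- `f : Ω → Ω` is a set-theoretic representative of an `O_F`-algebra homomorphism
`O_L → O_E / a_{E/F}^m`. -/
def IsHomMod (F L E : IntermediateField K Ω) (m : ℝ) (f : Ω → Ω) : Prop :=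
  (∀ x, IsInt v L x → IsInt v E (f x)) ∧
  (∀ x y, IsInt v L x → IsInt v L y → InId v F m (f (x + y) - (f x + f y))) ∧
  (∀ x y, IsInt v L x → IsInt v L y → InId v F m (f (x * y) - f x * f y)) ∧
  InId v F m (f 1 - 1) ∧
  (∀ c, IsInt v F c → InId v F m (f c - c))

/-- There exists an `O_F`-algebra homomorphism `O_L → O_E / a_{E/F}^m`. -/
def HomMod (F L E : IntermediateField K Ω) (m : ℝ) : Prop :=
  ∃ f : Ω → Ω, IsHomMod v F L E m f

/-- Fontaine's property (P_m) for the extension `L / F`. -/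
def PropP (F L : IntermediateField K Ω) (m : ℝ) : Prop :=
  ∀ E : IntermediateField K Ω, F ≤ E → HomMod v F L E m → L ≤ E

/-- `E / F` is totally ramified: the residue extension is trivial. -/
def TotRam (F E : IntermediateField K Ω) : Prop :=
  ∀ x, IsInt v E x → ∃ c, c ∈ F ∧ (c = 0 ∨ 0 ≤ v c) ∧ (x - c = 0 ∨ 0 < v (x - c))

/-- Property (P_m^tr) for `L / F`: (P_m) restricted to totally ramified `E / F`. -/
def PropPtr (F L : IntermediateField K Ω) (m : ℝ) : Prop :=
  ∀ E : IntermediateField K Ω, F ≤ E → TotRam v F E → HomMod v F L E m → L ≤ E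

/-- `E / F` is unramified: `F ≤ E` and the value group does not grow
(the residue fields being perfect, this is the usual notion). -/
def Unram (F E : IntermediateField K Ω) : Prop :=
  F ≤ E ∧ ∀ x : Ω, x ∈ E → x ≠ 0 → ∃ n : ℤ, vRel v F x = (n : ℝ)

/-- The elements of `Gal(L/K)` fixing `F` pointwise, i.e. `Gal(L/F)`. -/
def relGal (F L : IntermediateField K Ω) : Set (↥L ≃ₐ[K] ↥L) :=
  {σ | ∀ x : ↥L, (x : Ω) ∈ F → σ x = x}

/-- `σ` lies in the ramification group `Gal(L/F)_{(i)}` in Fontaine's lower numbering: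
`σ ∈ Gal(L/F)` and `v_F (σ x - x) ≥ i` for all integers `x` of `L`. -/
def lowerAt (F L : IntermediateField K Ω) (σ : ↥L ≃ₐ[K] ↥L) (i : ℝ) : Prop :=
  σ ∈ relGal F L ∧
    ∀ x : ↥L, IsInt v L (x : Ω) → (σ x = x ∨ i ≤ vRel v F ((σ x : Ω) - (x : Ω)))

/-- Fontaine's function `i_{L/F}(σ) = min_{x ∈ O_L} v_F (σ x - x)`. -/
def iFon (F L : IntermediateField K Ω) (σ : ↥L ≃ₐ[K] ↥L) : ℝ :=
  sSup {i : ℝ | lowerAt v F L σ i}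

/-- `i_{L/F}`: the largest `i` with `Gal(L/F)_{(i)}` nontrivial. -/
def iBreak (F L : IntermediateField K Ω) : ℝ :=
  sSup {i : ℝ | ∃ σ : ↥L ≃ₐ[K] ↥L, σ ≠ 1 ∧ lowerAt v F L σ i}

/-- Fontaine's Herbrand function `φ̃_{L/F}(t) = t + ∑_{1 ≠ σ ∈ Gal(L/F)} min (i_{L/F}(σ)) t`
(valid for `t ≥ 0` when the residue extension is separable). -/
def phiT (F L : IntermediateField K Ω) (t : ℝ) : ℝ :=
  t + ∑ᶠ σ ∈ {σ : ↥L ≃ₐ[K] ↥L | σ ∈ relGal F L ∧ σ ≠ 1}, min (iFon v F L σ) t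

/-- The maximal upper ramification break `u_{L/F} = φ̃_{L/F}(i_{L/F})`
(in Fontaine's numbering). -/
def uBreak (F L : IntermediateField K Ω) : ℝ := phiT v F L (iBreak v F L)

/-- Fontaine's inverse Herbrand function `ψ̃_{L/F}`. -/
def psiT (F L : IntermediateField K Ω) (u : ℝ) : ℝ :=
  sInf {t : ℝ | 0 ≤ t ∧ u ≤ phiT v F L t}

/-- Serre's inverse Herbrand function `ψ_{L/K}(u) = e_{L/K} ψ̃_{L/K}(u+1) - 1`. -/
def serrePsi (L : IntermediateField K Ω) (u : ℝ) : ℝ :=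
  ramIdx v L * psiT v ⊥ L (u + 1) - 1

/-- `L/K` has a unique jump in the ramification filtration of its Galois group:
`Gal(L/K)^{(u)} = Gal(L/K)` for all `u ≤ u_{L/K}`; equivalently, all
`i_{L/K}(σ)`, `σ ≠ 1`, are equal to `i_{L/K}`. -/
def UniqueJump (L : IntermediateField K Ω) : Prop :=
  ∀ σ : ↥L ≃ₐ[K] ↥L, σ ≠ 1 → iFon v ⊥ L σ = iBreak v ⊥ L

/-- The fixed field `M` of `Gal(L/K)^{(u_{L/K})} = Gal(L/K)_{(i_{L/K})}` inside `L`,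
as an intermediate field of `Ω / K`. -/
def ramFixed (L : IntermediateField K Ω) : IntermediateField K Ω where
  carrier := {x : Ω | ∃ hx : x ∈ L, ∀ σ : ↥L ≃ₐ[K] ↥L,
    lowerAt v ⊥ L σ (iBreak v ⊥ L) → σ ⟨x, hx⟩ = ⟨x, hx⟩}
  mul_mem' := by
    rintro a b ⟨ha, pa⟩ ⟨hb, pb⟩
    refine ⟨mul_mem ha hb, fun σ hσ => ?_⟩
    have h : (⟨a * b, mul_mem ha hb⟩ : ↥L) = ⟨a, ha⟩ * ⟨b, hb⟩ := rfl
    rw [h, map_mul, pa σ hσ, pb σ hσ]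
  one_mem' := by
    refine ⟨one_mem L, fun σ hσ => ?_⟩
    have h : (⟨(1 : Ω), one_mem L⟩ : ↥L) = 1 := rfl
    rw [h, map_one]
  add_mem' := by
    rintro a b ⟨ha, pa⟩ ⟨hb, pb⟩
    refine ⟨add_mem ha hb, fun σ hσ => ?_⟩
    have h : (⟨a + b, add_mem ha hb⟩ : ↥L) = ⟨a, ha⟩ + ⟨b, hb⟩ := rfl
    rw [h, map_add, pa σ hσ, pb σ hσ]
  zero_mem' := by
    refine ⟨zero_mem L, fun σ hσ => ?_⟩
    have h : (⟨(0 : Ω), zero_mem L⟩ : ↥L) = 0 := rfl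
    rw [h, map_zero]
  algebraMap_mem' := by
    intro r
    refine ⟨IntermediateField.algebraMap_mem L r, fun σ hσ => ?_⟩
    have h : (⟨algebraMap K Ω r, IntermediateField.algebraMap_mem L r⟩ : ↥L)
        = algebraMap K ↥L r := rfl
    rw [h, AlgEquiv.commutes]
  inv_mem' := by
    rintro a ⟨ha, pa⟩
    refine ⟨IntermediateField.inv_mem L ha, fun σ hσ => ?_⟩
    have h : (⟨a⁻¹, IntermediateField.inv_mem L ha⟩ : ↥L) = (⟨a, ha⟩ : ↥L)⁻¹ := by
      apply Subtype.ext
      rw [IntermediateField.coe_inv]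
    rw [h, map_inv₀, pa σ hσ]

section Res

variable {Ω : Type} [Field Ω] (v : Ω → ℝ) (K : Type) [Field K] [Algebra K Ω]

/-- `x ∈ K` is an integer of `K`. -/
def IsIntK (x : K) : Prop := x = 0 ∨ 0 ≤ v (algebraMap K Ω x)

/-- The residue field of `K` has characteristic `p`. -/
def ResidueCharP (p : ℕ) : Prop :=
  (p : K) = 0 ∨ 0 < v (algebraMap K Ω (p : K))

/-- The Frobenius of the residue field of `K` at `p` is surjective. -/
def PerfectResidueAt (p : ℕ) : Prop :=
  ∀ x : K, IsIntK v K x → ∃ y : K, IsIntK v K y ∧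
    (x - y ^ p = 0 ∨ 0 < v (algebraMap K Ω (x - y ^ p)))

/-- The residue field of `K` is perfect. -/
def PerfectResidue : Prop :=
  ∀ p : ℕ, p.Prime → ResidueCharP v K p → PerfectResidueAt v K p

/-- The residue field of `K` is algebraically closed. -/
def ResidueAlgClosed : Prop :=
  ∀ q : Polynomial K, q.Monic → 0 < q.natDegree → (∀ i, IsIntK v K (q.coeff i)) →
    ∃ x : K, IsIntK v K x ∧
      (Polynomial.eval x q = 0 ∨ 0 < v (algebraMap K Ω (Polynomial.eval x q)))

/-- `ρ : K → k` realizes `k` as the residue field of `K`: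
on the integers of `K` it is the residue (reduction) map. -/
def IsResidueMap {k : Type} [Field k] (ρ : K → k) : Prop :=
  (∀ x y : K, IsIntK v K x → IsIntK v K y → ρ (x + y) = ρ x + ρ y) ∧
  (∀ x y : K, IsIntK v K x → IsIntK v K y → ρ (x * y) = ρ x * ρ y) ∧
  ρ 1 = 1 ∧
  (∀ a : k, ∃ x : K, IsIntK v K x ∧ ρ x = a) ∧
  (∀ x : K, IsIntK v K x → (ρ x = 0 ↔ (x = 0 ∨ 0 < v (algebraMap K Ω x))))

/-- The group `U_K^n` of `n`-th principal units of `K` (for `n ≥ 1`),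
as a subgroup of `Kˣ`. -/
def prinK (n : ℝ) : Subgroup Kˣ :=
  Subgroup.closure {u : Kˣ | (u : K) = 1 ∨ n ≤ v (algebraMap K Ω ((u : K) - 1))}

end Res

/-- The group `U_E^n` of `n`-th principal units of an intermediate field `E`
(for `n ≥ 1`), with respect to the normalized valuation `v_E` of `E`,
as a subgroup of `(↥E)ˣ`. -/
def prinE {K Ω : Type} [Field K] [Field Ω] [Algebra K Ω] (v : Ω → ℝ)
    (E : IntermediateField K Ω) (n : ℝ) : Subgroup (↥E)ˣ :=
  Subgroup.closure {u : (↥E)ˣ | ((u : ↥E) : Ω) = 1 ∨ n ≤ vRel v E (((u : ↥E) : Ω) - 1)}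

end Fontaine

open Fontaine

open Polynomial in
/-- Two roots of a polynomial over a domain with the same reduction coincide if the reduction is a
simple root of the reduced polynomial. -/
theorem eq_of_isRoot_of_map_eq {A κ : Type*} [CommRing A] [IsDomain A] [CommRing κ]
    (φ : A →+* κ) (p : A[X]) {r s : A} (hr : p.IsRoot r) (hs : p.IsRoot s) (h : φ r = φ s)
    (hd : (derivative (p.map φ)).eval (φ r) ≠ 0) : r = s := by
  obtain ⟨q, rfl⟩ := dvd_iff_isRoot.mpr hr
  by_contra hne
  have hq : q.eval s = 0 := by
    have hs' := hs
    simp only [IsRoot, eval_mul, eval_sub, eval_X, eval_C, mul_eq_zero] at hs'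
    exact hs'.resolve_left (sub_ne_zero.mpr (Ne.symm hne))
  apply hd
  have : (q.map φ).eval (φ r) = 0 := by rw [h, eval_map_apply, hq, map_zero]
  simp [derivative_mul, this]

namespace Fontaine

/-- The residue field of a subfield `S` for the valuation ring `A`, inside that of `A`. -/
def resField {F : Type*} [Field F] (A : ValuationSubring F) (S : Subfield F) :
    Subfield (IsLocalRing.ResidueField A) where
  carrier := {y | ∃ a : A, (a : F) ∈ S ∧ IsLocalRing.residue A a = y}
  mul_mem' := by
    rintro _ _ ⟨a, ha, rfl⟩ ⟨b, hb, rfl⟩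
    exact ⟨a * b, mul_mem ha hb, map_mul _ _ _⟩
  one_mem' := ⟨1, one_mem S, map_one _⟩
  add_mem' := by
    rintro _ _ ⟨a, ha, rfl⟩ ⟨b, hb, rfl⟩
    exact ⟨a + b, add_mem ha hb, map_add _ _ _⟩
  zero_mem' := ⟨0, zero_mem S, map_zero _⟩
  neg_mem' := by
    rintro _ ⟨a, ha, rfl⟩
    exact ⟨-a, neg_mem ha, map_neg _ _⟩
  inv_mem' := by
    rintro _ ⟨a, ha, rfl⟩
    by_cases h : IsUnit a
    · obtain ⟨u, rfl⟩ := h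
      refine ⟨((u⁻¹ : Aˣ) : A), ?_, map_units_inv _ _⟩
      have : (((u⁻¹ : Aˣ) : A) : F) = ((u : A) : F)⁻¹ :=
        eq_inv_of_mul_eq_one_left (congrArg Subtype.val u.inv_mul)
      rw [this]
      exact inv_mem ha
    · have : IsLocalRing.residue A a = 0 := (IsLocalRing.residue_eq_zero_iff a).mpr h
      exact ⟨0, zero_mem S, by simp [this]⟩

theorem resField_mono {F : Type*} [Field F] (A : ValuationSubring F) {S T : Subfield F}
    (h : S ≤ T) : resField A S ≤ resField A T := by
  rintro _ ⟨a, ha, rfl⟩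
  exact ⟨a, h ha, rfl⟩

namespace IsCDV

variable {K Ω : Type} [Field K] [Field Ω] [Algebra K Ω] {v : Ω → ℝ}

theorem v_one (hv : IsCDV K Ω v) : v 1 = 0 := by
  have := hv.map_mul 1 1 one_ne_zero one_ne_zero
  rw [mul_one] at this
  linarith

theorem v_neg (hv : IsCDV K Ω v) (x : Ω) : v (-x) = v x := by
  by_cases hx : x = 0
  · simp [hx]
  have h1 : v (-1) = 0 := by
    have := hv.map_mul (-1) (-1) (by simp) (by simp)
    rw [neg_one_mul, neg_neg, hv.v_one] at this
    linarith
  rw [← neg_one_mul, hv.map_mul _ _ (by simp) hx, h1, zero_add]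

theorem v_inv (hv : IsCDV K Ω v) {x : Ω} (hx : x ≠ 0) : v x⁻¹ = - v x := by
  have := hv.map_mul x x⁻¹ hx (inv_ne_zero hx)
  rw [mul_inv_cancel₀ hx, hv.v_one] at this
  linarith

/-- The valuation ring of `v` in `Ω`. -/
def valRing (hv : IsCDV K Ω v) : ValuationSubring Ω where
  carrier := {x | x = 0 ∨ 0 ≤ v x}
  mul_mem' := by
    intro a b ha hb
    by_cases h : a = 0 ∨ b = 0
    · left
      simpa using h
    · push Not at h
      right
      rw [hv.map_mul _ _ h.1 h.2]
      exact add_nonneg (ha.resolve_left h.1) (hb.resolve_left h.2)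
  one_mem' := Or.inr hv.v_one.ge
  add_mem' := by
    intro a b ha hb
    by_cases h0 : a = 0
    · simpa [h0] using hb
    by_cases h1 : b = 0
    · simpa [h1] using ha
    by_cases h2 : a + b = 0
    · exact Or.inl h2
    · exact Or.inr ((le_min (ha.resolve_left h0) (hb.resolve_left h1)).trans
        (hv.add_ge a b h0 h1 h2))
  zero_mem' := Or.inl rfl
  neg_mem' := by
    intro a ha
    simpa [hv.v_neg] using ha
  mem_or_inv_mem' := by
    intro x
    by_cases h : x = 0
    · exact Or.inl (Or.inl h)
    rcases le_total 0 (v x) with h' | h'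
    · exact Or.inl (Or.inr h')
    · exact Or.inr (Or.inr (by rw [hv.v_inv h]; linarith))

theorem mem_valRing (hv : IsCDV K Ω v) {x : Ω} : x ∈ hv.valRing ↔ x = 0 ∨ 0 ≤ v x := Iff.rfl

theorem residue_eq_zero (hv : IsCDV K Ω v) (x : hv.valRing) :
    IsLocalRing.residue hv.valRing x = 0 ↔ (x : Ω) = 0 ∨ 0 < v x := by
  rw [IsLocalRing.residue_eq_zero_iff, IsLocalRing.mem_maximalIdeal, mem_nonunits_iff]
  constructor
  · intro h
    by_contra! hx
    have hi : (x : Ω)⁻¹ ∈ hv.valRing :=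
      hv.mem_valRing.mpr (Or.inr (by rw [hv.v_inv hx.1]; linarith [hx.2]))
    exact h (IsUnit.of_mul_eq_one ⟨_, hi⟩ (Subtype.ext (mul_inv_cancel₀ hx.1)))
  · rintro h ⟨u, rfl⟩
    have h0 : ((u : hv.valRing) : Ω) ≠ 0 := by
      intro h
      exact u.ne_zero (Subtype.ext h)
    have hi : ((u⁻¹ : hv.valRingˣ) : hv.valRing).1 = ((u : hv.valRing) : Ω)⁻¹ :=
      eq_inv_of_mul_eq_one_left (congrArg Subtype.val u.inv_mul)
    have h1 := hv.mem_valRing.mp ((u⁻¹ : hv.valRingˣ) : hv.valRing).2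
    rw [hi, hv.v_inv h0] at h1
    have h2 := h1.resolve_left (inv_ne_zero h0)
    have h3 := h.resolve_left h0
    linarith

theorem residue_eq_residue (hv : IsCDV K Ω v) (x y : hv.valRing) :
    IsLocalRing.residue hv.valRing x = IsLocalRing.residue hv.valRing y ↔
      (x - y : Ω) = 0 ∨ 0 < v (x - y) := by
  rw [← sub_eq_zero, ← map_sub, hv.residue_eq_zero]
  simp

theorem v_algEquiv (hv : IsCDV K Ω v) (τ : Ω ≃ₐ[K] Ω) (x : Ω) : v (τ x) = v x := by
  have := hv.galois_inv ⊤
    ((IntermediateField.topEquiv.trans τ).trans IntermediateField.topEquiv.symm)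
    ⟨x, trivial⟩
  exact this

/-- The residue field of `K`. -/
abbrev baseRes (hv : IsCDV K Ω v) : Subfield (IsLocalRing.ResidueField hv.valRing) :=
  resField hv.valRing (algebraMap K Ω).fieldRange

/-- The valuation of a linear combination of elements with independent residues is attained by one
of the coefficients. -/
theorem exists_v_sum_eq (hv : IsCDV K Ω v) {ι : Type*} [Fintype ι] (b : ι → hv.valRing)
    (hb : LinearIndependent hv.baseRes (fun i => IsLocalRing.residue hv.valRing (b i)))
    (c : ι → K) (hc : c ≠ 0) :
    ∑ i, c i • (b i : Ω) ≠ 0 ∧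
      ∃ j, c j ≠ 0 ∧ v (∑ i, c i • (b i : Ω)) = v (algebraMap K Ω (c j)) := by
  obtain ⟨j₀, hj₀⟩ := Function.ne_iff.mp hc
  obtain ⟨j, hj, hmin⟩ := Finset.exists_min_image (Finset.univ.filter fun i => c i ≠ 0)
    (fun i => v (algebraMap K Ω (c i))) ⟨j₀, by simpa using hj₀⟩
  simp only [Finset.mem_filter, Finset.mem_univ, true_and] at hj hmin
  have hj' : algebraMap K Ω (c j) ≠ 0 := by simpa using hj
  have hd : ∀ i, algebraMap K Ω (c i / c j) ∈ hv.valRing := by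
    intro i
    rw [hv.mem_valRing]
    by_cases hi : c i = 0
    · simp [hi]
    · right
      have hi' : algebraMap K Ω (c i) ≠ 0 := by simpa using hi
      rw [div_eq_mul_inv, _root_.map_mul, map_inv₀, hv.map_mul _ _ hi' (inv_ne_zero hj'), hv.v_inv hj']
      linarith [hmin i hi]
  set d : ι → hv.valRing := fun i => ⟨_, hd i⟩
  set s : hv.valRing := ∑ i, d i * b i with hs
  have hsum : ∑ i, c i • (b i : Ω) = algebraMap K Ω (c j) * s := by
    rw [hs, AddSubmonoidClass.coe_finsetSum, Finset.mul_sum]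
    refine Finset.sum_congr rfl fun i _ => ?_
    simp only [d, MulMemClass.coe_mul, Algebra.smul_def, map_div₀]
    field_simp
  have hs0 : IsLocalRing.residue hv.valRing s ≠ 0 := by
    intro h0
    have hl := Fintype.linearIndependent_iff.mp hb
      (fun i => ⟨IsLocalRing.residue hv.valRing (d i), d i, ⟨_, rfl⟩, rfl⟩)
      (by
        rw [← h0, hs, map_sum]
        exact Finset.sum_congr rfl fun i _ => (_root_.map_mul _ _ _).symm) j
    have hdj : d j = 1 := Subtype.ext (by simp [d, hj])
    have := congrArg Subtype.val hl
    simp [hdj] at this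
  rw [ne_eq, hv.residue_eq_zero, not_or, not_lt] at hs0
  have hvs : v s = 0 := le_antisymm hs0.2 ((hv.mem_valRing.mp s.2).resolve_left hs0.1)
  rw [hsum]
  exact ⟨mul_ne_zero hj' hs0.1, j, hj, by rw [hv.map_mul _ _ hj' hs0.1, hvs, add_zero]⟩

theorem baseRes_le (hv : IsCDV K Ω v) (L : IntermediateField K Ω) :
    hv.baseRes ≤ resField hv.valRing L.toSubfield :=
  resField_mono _ (by
    rintro _ ⟨c, rfl⟩
    exact L.algebraMap_mem c)

/-- The residue field of `L`, as an extension of that of `K`. -/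
abbrev extRes (hv : IsCDV K Ω v) (L : IntermediateField K Ω) :
    IntermediateField hv.baseRes (IsLocalRing.ResidueField hv.valRing) :=
  Subfield.extendScalars (hv.baseRes_le L)

theorem mem_extRes (hv : IsCDV K Ω v) (L : IntermediateField K Ω)
    {y : IsLocalRing.ResidueField hv.valRing} :
    y ∈ hv.extRes L ↔ ∃ a : hv.valRing, (a : Ω) ∈ L ∧ IsLocalRing.residue hv.valRing a = y :=
  Iff.rfl

theorem finiteDimensional_extRes (hv : IsCDV K Ω v) (L : IntermediateField K Ω)
    [FiniteDimensional K L] : FiniteDimensional hv.baseRes (hv.extRes L) := by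
  have : Module.rank hv.baseRes (hv.extRes L) ≤ (Module.finrank K L : ℕ) := by
    refine rank_le fun s hs => ?_
    choose b hbL hb using fun i : s => (hv.mem_extRes L).mp i.1.2
    have hs' : LinearIndependent hv.baseRes
        (fun i => IsLocalRing.residue hv.valRing (b i)) := by
      simp only [hb]
      exact hs.map' (hv.extRes L).val.toLinearMap
        (LinearMap.ker_eq_bot.mpr (hv.extRes L).val.injective)
    have hli : LinearIndependent K (fun i => (⟨b i, hbL i⟩ : L)) := by
      rw [Fintype.linearIndependent_iff]
      intro c hc
      by_contra! hne
      obtain ⟨j, hj⟩ := hne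
      refine (hv.exists_v_sum_eq b hs' c (fun h => hj (congrFun h j))).1 ?_
      simpa using congrArg (L.val) hc
    simpa using hli.fintype_card_le_finrank
  exact Module.rank_lt_aleph0_iff.mp (this.trans_lt (Cardinal.natCast_lt_aleph0))

theorem perfectField_baseRes (hv : IsCDV K Ω v) (hperf : PerfectResidue v K) :
    PerfectField hv.baseRes := by
  obtain ⟨p, hp⟩ := CharP.exists hv.baseRes
  rcases CharP.char_is_prime_or_zero hv.baseRes p with hpp | rfl
  · have := Fact.mk hpp
    have : ExpChar hv.baseRes p := ExpChar.prime hpp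
    have hres : ResidueCharP v K p := by
      have h0 : IsLocalRing.residue hv.valRing (p : hv.valRing) = 0 := by
        rw [map_natCast, ← map_natCast (algebraMap hv.baseRes _), CharP.cast_eq_zero, map_zero]
      rw [hv.residue_eq_zero] at h0
      have he : ((p : hv.valRing) : Ω) = algebraMap K Ω (p : K) := by simp
      rw [he] at h0
      exact h0.imp_left (map_eq_zero _).mp
    have : Function.Surjective (frobenius hv.baseRes p) := by
      rintro ⟨_, a, ⟨x, hx⟩, rfl⟩
      have hxi : IsIntK v K x := by
        have := hv.mem_valRing.mp a.2
        rw [← hx] at this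
        exact this.imp_left fun h => by simpa using h
      obtain ⟨y, hy, hxy⟩ := hperf p hpp hres x hxi
      have hyA : algebraMap K Ω y ∈ hv.valRing := hy.imp_left fun h => by simp [h]
      refine ⟨⟨_, ⟨_, hyA⟩, ⟨y, rfl⟩, rfl⟩, Subtype.ext ?_⟩
      rw [frobenius_def, SubmonoidClass.coe_pow]
      simp only
      rw [← map_pow, eq_comm, hv.residue_eq_residue]
      simp only [SubmonoidClass.coe_pow, ← hx, ← map_pow, ← map_sub]
      exact hxy.imp_left fun h => by rw [h, map_zero]
    have := PerfectRing.ofSurjective hv.baseRes p this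
    exact PerfectRing.toPerfectField hv.baseRes p
  · have := CharP.charP_to_charZero hv.baseRes
    exact PerfectField.ofCharZero

/-- The ring of integers of `K`. -/
abbrev baseInt (hv : IsCDV K Ω v) : Subring K := hv.valRing.toSubring.comap (algebraMap K Ω)

/-- The inclusion of the integers of `K` in those of `Ω`. -/
def baseIncl (hv : IsCDV K Ω v) : hv.baseInt →+* hv.valRing :=
  ((algebraMap K Ω).comp hv.baseInt.subtype).codRestrict hv.valRing (fun x => x.2)

open Polynomial in
/-- A root of the reduction of a monic polynomial lifts to a root in `Ω`. -/
theorem exists_isRoot_residue_eq [IsAlgClosed Ω] (hv : IsCDV K Ω v) (p : hv.valRing[X])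
    (hp : p.Monic) (α : IsLocalRing.ResidueField hv.valRing)
    (hα : (p.map (IsLocalRing.residue hv.valRing)).IsRoot α) :
    ∃ r : hv.valRing, IsLocalRing.residue hv.valRing r = α ∧ p.IsRoot r := by
  obtain ⟨θ, rfl⟩ := IsLocalRing.residue_surjective α
  rw [IsRoot, eval_map_apply, hv.residue_eq_zero] at hα
  set P := p.map hv.valRing.subtype
  have hP : P.eval (θ : Ω) = (p.eval θ : hv.valRing) :=
    eval_map_apply (f := hv.valRing.subtype) (p := p) θ
  rw [← hP, (IsAlgClosed.splits P).eval_eq_prod_roots_of_monic (hp.map _)] at hα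
  have key : ∃ r ∈ P.roots, ((θ : Ω) - r = 0 ∨ 0 < v (θ - r)) := by
    by_contra! hne
    have := Multiset.prod_induction (fun x => x ≠ 0 ∧ v x ≤ 0)
      (P.roots.map fun r => (θ : Ω) - r)
      (fun a b ha hb => ⟨mul_ne_zero ha.1 hb.1, by
        rw [hv.map_mul _ _ ha.1 hb.1]; linarith [ha.2, hb.2]⟩)
      ⟨one_ne_zero, hv.v_one.le⟩ (by
        intro a ha
        obtain ⟨r, hr, rfl⟩ := Multiset.mem_map.mp ha
        exact hne r hr)
    rcases hα with h | h
    · exact this.1 h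
    · exact absurd this.2 (not_le.mpr h)
  obtain ⟨r, hr, hθ⟩ := key
  have hrA : r ∈ hv.valRing := by
    have : (θ : Ω) - r ∈ hv.valRing := hθ.imp_right le_of_lt
    simpa using sub_mem θ.2 this
  refine ⟨⟨r, hrA⟩, ((hv.residue_eq_residue _ _).mpr hθ).symm, Subtype.ext ?_⟩
  have h1 := isRoot_of_mem_roots hr
  have h2 : P.eval r = (p.eval ⟨r, hrA⟩ : hv.valRing) :=
    eval_map_apply (f := hv.valRing.subtype) (p := p) ⟨r, hrA⟩
  rw [← h2]
  exact h1

open Polynomial in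
/-- The minimal polynomial of an integral residue class lifts to a monic integral polynomial. -/
theorem exists_lift_minpoly (hv : IsCDV K Ω v) (α : IsLocalRing.ResidueField hv.valRing)
    (hα : IsIntegral hv.baseRes α) :
    ∃ g : hv.baseInt[X], g.Monic ∧ g.natDegree = (minpoly hv.baseRes α).natDegree ∧
      (g.map hv.baseIncl).map (IsLocalRing.residue hv.valRing) =
        (minpoly hv.baseRes α).map (algebraMap _ _) := by
  obtain ⟨g, h1, h2, h3⟩ := lifts_and_natDegree_eq_and_monic
    (f := (IsLocalRing.residue hv.valRing).comp hv.baseIncl)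
    (p := (minpoly hv.baseRes α).map (algebraMap _ (IsLocalRing.ResidueField hv.valRing)))
    (by
      rw [lifts_iff_coeff_lifts]
      intro n
      rw [coeff_map]
      obtain ⟨a, ⟨x, hx⟩, ha⟩ := ((minpoly hv.baseRes α).coeff n).2
      have hxA : algebraMap K Ω x ∈ hv.valRing := by
        have := a.2
        rwa [← hx] at this
      have hxa : hv.baseIncl ⟨x, hxA⟩ = a := Subtype.ext hx
      exact ⟨⟨x, hxA⟩, (congrArg (IsLocalRing.residue hv.valRing) hxa).trans ha⟩)
    ((minpoly.monic hα).map _)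
  exact ⟨g, h3, by rw [h2, natDegree_map], by rw [Polynomial.map_map, h1]⟩

/-- There is an extension `E / K` with integral values whose residue field contains that of `L`, and
which is fixed by every automorphism acting trivially on the residue field of `L`. -/
theorem exists_unramified_lift [IsAlgClosure K Ω] (hv : IsCDV K Ω v) (hperf : PerfectResidue v K)
    (L : IntermediateField K Ω) [FiniteDimensional K L] :
    ∃ E : IntermediateField K Ω,
      (∀ x ∈ E, x ≠ 0 → ∃ n : ℤ, v x = n) ∧
      (∀ x, IsInt v L x → ∃ y, IsInt v E y ∧ (x - y = 0 ∨ 0 < v (x - y))) ∧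
      ∀ τ : Ω ≃ₐ[K] Ω, (∀ x, IsInt v L x → τ x = x ∨ 0 < v (τ x - x)) → ∀ x ∈ E, τ x = x := by
  have := IsAlgClosure.isAlgClosed (R := K) (K := Ω)
  have := hv.perfectField_baseRes hperf
  have := hv.finiteDimensional_extRes L
  obtain ⟨α, hα⟩ := Field.exists_primitive_element hv.baseRes (hv.extRes L)
  have hint : IsIntegral hv.baseRes (α : IsLocalRing.ResidueField hv.valRing) :=
    (Algebra.IsIntegral.isIntegral (R := hv.baseRes) α).map (hv.extRes L).val
  obtain ⟨g, hgm, hgd, hg⟩ := hv.exists_lift_minpoly α hint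
  have hroot : ((minpoly hv.baseRes (α : IsLocalRing.ResidueField hv.valRing)).map
      (algebraMap _ (IsLocalRing.ResidueField hv.valRing))).IsRoot α := by
    rw [Polynomial.IsRoot, Polynomial.eval_map_algebraMap, minpoly.aeval]
  obtain ⟨r, hrα, hr⟩ := hv.exists_isRoot_residue_eq (g.map hv.baseIncl) (hgm.map _) α
    (by rwa [hg])
  have hgr : Polynomial.aeval (r : Ω) (g.map hv.baseInt.subtype) = 0 := by
    have h1 := congrArg (hv.valRing.subtype) hr
    rw [← Polynomial.eval_map_apply, Polynomial.map_map, map_zero] at h1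
    rw [← Polynomial.eval_map_algebraMap, Polynomial.map_map]
    exact h1
  have hrint : IsIntegral K (r : Ω) := ⟨_, hgm.map _, hgr⟩
  refine ⟨IntermediateField.adjoin K {(r : Ω)}, ?_, ?_, ?_⟩
  · intro x hx hx0
    rw [← IntermediateField.mem_toSubalgebra,
      IntermediateField.adjoin_simple_toSubalgebra_of_isAlgebraic hrint.isAlgebraic,
      Algebra.adjoin_singleton_eq_range_aeval] at hx
    obtain ⟨p, rfl⟩ := hx
    set G := g.map hv.baseInt.subtype
    have hGm : G.Monic := hgm.map _
    have hdeg : (p %ₘ G).natDegree <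
        (minpoly hv.baseRes (α : IsLocalRing.ResidueField hv.valRing)).natDegree := by
      have hGd : G.natDegree = _ := (hgm.natDegree_map _).trans hgd
      rw [← hGd]
      refine Polynomial.natDegree_modByMonic_lt p hGm fun h => ?_
      rw [h, Polynomial.natDegree_one] at hGd
      exact (minpoly.natDegree_pos hint).ne hGd
    have hxs : Polynomial.aeval (r : Ω) p =
        ∑ i : Fin (minpoly hv.baseRes (α : IsLocalRing.ResidueField hv.valRing)).natDegree,
          (p %ₘ G).coeff i • ((r ^ (i : ℕ) : hv.valRing) : Ω) := by
      rw [← Polynomial.aeval_modByMonic_eq_self_of_root hgr,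
        Polynomial.aeval_eq_sum_range' hdeg, Finset.sum_range]
      simp
    have hx0' : Polynomial.aeval (r : Ω) p ≠ 0 := hx0
    change ∃ n : ℤ, v (Polynomial.aeval (r : Ω) p) = n
    rw [hxs] at hx0' ⊢
    obtain ⟨-, j, hj, hvj⟩ := hv.exists_v_sum_eq (fun i : Fin _ => r ^ (i : ℕ))
      (by simpa only [map_pow, hrα] using linearIndependent_pow (K := hv.baseRes)
            (α : IsLocalRing.ResidueField hv.valRing))
      (fun i => (p %ₘ G).coeff i)
      (fun h => hx0' (Finset.sum_eq_zero fun i _ => by rw [congrFun h i]; simp))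
    rw [hvj]
    exact hv.int_valued _ hj
  · intro x hx
    have hle : hv.extRes L ≤ hv.extRes (IntermediateField.adjoin K {(r : Ω)}) := by
      rw [← IntermediateField.lift_top hv.baseRes (hv.extRes L), ← hα,
        IntermediateField.lift_adjoin_simple, IntermediateField.adjoin_simple_le_iff]
      exact (hv.mem_extRes _).mpr ⟨r, IntermediateField.mem_adjoin_simple_self K _, hrα⟩
    obtain ⟨a, haE, ha⟩ := (hv.mem_extRes _).mp
      (hle ((hv.mem_extRes L).mpr ⟨⟨x, hx.2⟩, hx.1, rfl⟩))
    exact ⟨a, ⟨haE, a.2⟩, (hv.residue_eq_residue _ _).mp ha.symm⟩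
  · intro τ hτ
    obtain ⟨θ, hθL, hθ⟩ := (hv.mem_extRes L).mp α.2
    have hmap : ∀ a : hv.valRing, τ a ∈ hv.valRing := fun a => by
      rcases hv.mem_valRing.mp a.2 with h | h
      · exact Or.inl (by simp [h])
      · exact Or.inr (by rwa [hv.v_algEquiv])
    have hs : (g.map hv.baseIncl).IsRoot ⟨τ r, hmap r⟩ := by
      refine Subtype.ext ?_
      have h1 := congrArg τ hgr
      rw [← Polynomial.aeval_algHom_apply, map_zero, ← Polynomial.eval_map_algebraMap,
        Polynomial.map_map] at h1
      refine Eq.trans ?_ h1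
      refine (Polynomial.eval_map_apply (f := hv.valRing.subtype) _).symm.trans ?_
      rw [Polynomial.map_map]
      rfl
    have hres : IsLocalRing.residue hv.valRing r =
        IsLocalRing.residue hv.valRing ⟨τ r, hmap r⟩ := by
      have h1 : IsLocalRing.residue hv.valRing ⟨τ r, hmap r⟩ =
          IsLocalRing.residue hv.valRing ⟨τ θ, hmap θ⟩ := by
        rw [hv.residue_eq_residue]
        have := (hv.residue_eq_residue r θ).mp (hrα.trans hθ.symm)
        simp only [← map_sub, hv.v_algEquiv]
        exact this.imp_left fun h => by rw [h, map_zero]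
      have h2 : IsLocalRing.residue hv.valRing ⟨τ θ, hmap θ⟩ = α := by
        rw [← hθ, hv.residue_eq_residue]
        exact (hτ θ ⟨hθL, θ.2⟩).imp_left sub_eq_zero.mpr
      rw [h1, h2, hrα]
    have hfix : τ r = r := by
      refine (congrArg Subtype.val (eq_of_isRoot_of_map_eq (IsLocalRing.residue hv.valRing)
        (g.map hv.baseIncl) hr hs hres ?_)).symm
      rw [hg, hrα, Polynomial.derivative_map, Polynomial.eval_map]
      refine Polynomial.Separable.eval₂_derivative_ne_zero _
        (PerfectField.separable_of_irreducible (minpoly.irreducible hint)) ?_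
      rw [← Polynomial.eval_map]
      exact hroot
    intro x hx
    induction hx using IntermediateField.adjoin_induction with
    | mem y hy => rw [Set.mem_singleton_iff.mp hy, hfix]
    | algebraMap c => exact τ.commutes c
    | add y z _ _ hy hz => rw [map_add, hy, hz]
    | inv y _ hy => rw [map_inv₀, hy]
    | mul y z _ _ hy hz => rw [_root_.map_mul, hy, hz]

theorem one_le_ramIdx (hv : IsCDV K Ω v) (F : IntermediateField K Ω)
    (hF : ∀ x ∈ F, x ≠ 0 → ∃ n : ℤ, v x = n) : 1 ≤ ramIdx v F := by
  obtain ⟨π, hπ⟩ := hv.exists_uniformizer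
  set S := {r : ℝ | 0 < r ∧ ∃ x ∈ F, v x = r}
  have h1 : (1 : ℝ) ∈ S := ⟨one_pos, _, F.algebraMap_mem π, hπ⟩
  have hlb : ∃ ε > 0, ∀ s ∈ S, ε ≤ s := by
    by_cases h0 : 0 < v 0
    · refine ⟨min 1 (v 0), lt_min one_pos h0, ?_⟩
      rintro s ⟨hs, x, hx, rfl⟩
      by_cases hx0 : x = 0
      · rw [hx0]
        exact min_le_right _ _
      · obtain ⟨n, hn⟩ := hF x hx hx0
        rw [hn] at hs ⊢
        exact (min_le_left _ _).trans (by exact_mod_cast hs)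
    · refine ⟨1, one_pos, ?_⟩
      rintro s ⟨hs, x, hx, rfl⟩
      by_cases hx0 : x = 0
      · rw [hx0] at hs
        exact absurd hs h0
      · obtain ⟨n, hn⟩ := hF x hx hx0
        rw [hn] at hs ⊢
        exact_mod_cast hs
  obtain ⟨ε, hε, hb⟩ := hlb
  exact (one_le_inv₀ (hε.trans_le (le_csInf ⟨1, h1⟩ hb))).mpr (csInf_le ⟨ε, hb⟩ h1)

theorem one_le_ramIdx_bot (hv : IsCDV K Ω v) : 1 ≤ ramIdx v (⊥ : IntermediateField K Ω) := by
  refine hv.one_le_ramIdx ⊥ ?_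
  intro x hx hx0
  obtain ⟨c, rfl⟩ := IntermediateField.mem_bot.mp hx
  exact hv.int_valued c (by simpa using hx0)

/-- If no nontrivial automorphism lies in the inertia group, the last upper break is at most `0`. -/
theorem uBreak_nonpos (hv : IsCDV K Ω v) (L : IntermediateField K Ω)
    (h : ∀ σ : L ≃ₐ[K] L, (∀ x : L, IsInt v L x → σ x = x ∨ 0 < v ((σ x : Ω) - x)) → σ = 1) :
    uBreak v ⊥ L ≤ 0 := by
  have hi : iBreak v ⊥ L ≤ 0 := by
    refine Real.sSup_nonpos ?_
    rintro i ⟨σ, hσ, -, hi⟩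
    by_contra! hpos
    refine hσ (h σ fun x hx => (hi x hx).imp_right fun hx' => ?_)
    exact pos_of_mul_pos_left (hpos.trans_le hx') (zero_le_one.trans hv.one_le_ramIdx_bot)
  refine add_nonpos hi (finsum_mem_induction (· ≤ 0) le_rfl (fun _ _ => add_nonpos) ?_)
  exact fun σ _ => (min_le_right _ _).trans hi

theorem homMod_of_nonpos (hv : IsCDV K Ω v) (L : IntermediateField K Ω) {m : ℝ} (hm : m ≤ 0) :
    HomMod v ⊥ L ⊥ m := by
  have h0 : (0 : ℝ) ≤ ramIdx v (⊥ : IntermediateField K Ω) :=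
    zero_le_one.trans hv.one_le_ramIdx_bot
  refine ⟨fun _ => 0, fun _ _ => ⟨zero_mem _, Or.inl rfl⟩, fun _ _ _ _ => Or.inl (by simp),
    fun _ _ _ _ => Or.inl (by simp), Or.inr ?_, fun c hc => ?_⟩
  · rw [zero_sub, vRel, hv.v_neg, hv.v_one, zero_mul]
    exact hm
  · rcases hc.2 with h | h
    · exact Or.inl (by simp [h])
    · right
      rw [zero_sub, vRel, hv.v_neg]
      exact hm.trans (mul_nonneg h h0)

/-- If `E` has integral values and every integer of `L` is congruent to one of `E`, then reduction
gives a homomorphism `O_L → O_E / a_{E/K}^m` for `m ≤ 1`. -/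
theorem homMod_of_le_one (hv : IsCDV K Ω v) (L E : IntermediateField K Ω)
    (hE : ∀ x ∈ E, x ≠ 0 → ∃ n : ℤ, v x = n)
    (hLE : ∀ x, IsInt v L x → ∃ y, IsInt v E y ∧ (x - y = 0 ∨ 0 < v (x - y)))
    {m : ℝ} (hm : m ≤ 1) : HomMod v ⊥ L E m := by
  choose! f hf hfx using hLE
  have hLmem : ∀ {x : Ω}, IsInt v L x → x ∈ hv.valRing := fun hx => hx.2
  have key : ∀ (x : Ω) (hx : x ∈ hv.valRing) (y : Ω) (hy : y ∈ hv.valRing), x ∈ E → y ∈ E →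
      IsLocalRing.residue hv.valRing ⟨x, hx⟩ = IsLocalRing.residue hv.valRing ⟨y, hy⟩ →
      InId v (⊥ : IntermediateField K Ω) m (x - y) := by
    intro x hx y hy hxE hyE h
    rw [hv.residue_eq_residue] at h
    by_cases h0 : x - y = 0
    · exact Or.inl h0
    obtain ⟨n, hn⟩ := hE _ (sub_mem hxE hyE) h0
    have hpos := h.resolve_left h0
    have h1 : (1 : ℝ) ≤ v (x - y) := by
      simp only [hn] at hpos ⊢
      exact_mod_cast hpos
    exact Or.inr (hm.trans (one_le_mul_of_one_le_of_one_le h1 hv.one_le_ramIdx_bot))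
  have hres : ∀ x (hx : IsInt v L x), IsLocalRing.residue hv.valRing ⟨f x, (hf x hx).2⟩ =
      IsLocalRing.residue hv.valRing ⟨x, hx.2⟩ := fun x hx =>
    ((hv.residue_eq_residue _ _).mpr (hfx x hx)).symm
  have hbot : ∀ c, IsInt v (⊥ : IntermediateField K Ω) c →
      InId v (⊥ : IntermediateField K Ω) m (f c - c) := by
    intro c hc
    have hcL : IsInt v L c := ⟨(bot_le : ⊥ ≤ L) hc.1, hc.2⟩
    exact key _ (hf c hcL).2 _ hc.2 (hf c hcL).1 ((bot_le : ⊥ ≤ E) hc.1) (hres c hcL)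
  refine ⟨f, hf, ?_, ?_, hbot 1 ⟨one_mem _, one_mem hv.valRing⟩, hbot⟩
  · intro x y hx hy
    have hxy : IsInt v L (x + y) := ⟨add_mem hx.1 hy.1, add_mem (hLmem hx) (hLmem hy)⟩
    refine key _ (hf _ hxy).2 _ (add_mem (S := ValuationSubring Ω) (hf x hx).2 (hf y hy).2)
      (hf _ hxy).1 (add_mem (hf x hx).1 (hf y hy).1) ?_
    refine (hres _ hxy).trans (Eq.trans ?_ (map_add (IsLocalRing.residue hv.valRing)
      ⟨f x, (hf x hx).2⟩ ⟨f y, (hf y hy).2⟩).symm)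
    rw [hres x hx, hres y hy, ← map_add]
    rfl
  · intro x y hx hy
    have hxy : IsInt v L (x * y) := ⟨mul_mem hx.1 hy.1, mul_mem (hLmem hx) (hLmem hy)⟩
    refine key _ (hf _ hxy).2 _ (mul_mem (S := ValuationSubring Ω) (hf x hx).2 (hf y hy).2)
      (hf _ hxy).1 (mul_mem (hf x hx).1 (hf y hy).1) ?_
    refine (hres _ hxy).trans (Eq.trans ?_ (_root_.map_mul (IsLocalRing.residue hv.valRing)
      ⟨f x, (hf x hx).2⟩ ⟨f y, (hf y hy).2⟩).symm)
    rw [hres x hx, hres y hy, ← _root_.map_mul]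
    rfl

end IsCDV

end Fontaine

/-- A nontrivial finite tame Galois extension `L/K` of a complete
discrete valuation field with perfect residue field does not satisfy (P_m) for
`m = u_{L/K}`. -/
theorem statement16
    (K Ω : Type) [Field K] [Field Ω] [Algebra K Ω] [IsAlgClosure K Ω]
    (v : Ω → ℝ) (hv : IsCDV K Ω v) (hperf : PerfectResidue v K)
    (L : IntermediateField K Ω) [FiniteDimensional K ↥L] [IsGalois K ↥L]
    (hnt : L ≠ ⊥) (htame : uBreak v ⊥ L ≤ 1) :
    ¬ PropP v ⊥ L (uBreak v ⊥ L) := by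
  intro hP
  by_cases h : ∀ σ : L ≃ₐ[K] L,
      (∀ x : L, IsInt v L x → σ x = x ∨ 0 < v ((σ x : Ω) - x)) → σ = 1
  · exact hnt (le_bot_iff.mp (hP ⊥ le_rfl (hv.homMod_of_nonpos L (hv.uBreak_nonpos L h))))
  · push Not at h
    obtain ⟨σ, hσ, hσ1⟩ := h
    obtain ⟨E, hE, hLE, hfix⟩ := hv.exists_unramified_lift hperf L
    have hle := hP E bot_le (hv.homMod_of_le_one L E hE hLE htame)
    have := IsAlgClosure.normal K Ω
    have hlift : ∀ x : L, σ.liftNormal Ω (x : Ω) = σ x := fun x => σ.liftNormal_commutes Ω x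
    have hτ := hfix (σ.liftNormal Ω) fun x hx => by
      rw [hlift ⟨x, hx.1⟩]
      exact (hσ ⟨x, hx.1⟩ hx).imp_left (congrArg Subtype.val)
    exact hσ1 (AlgEquiv.ext fun x => Subtype.ext ((hlift x).symm.trans (hτ x (hle x.2))))
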